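/- arXiv:2103.01473 — 2 statements merged into one kernel-verified Lean document; each statement's English description precedes it below -/
import Mathlib

section
/- Suppose cos θ0 ≠ sin θ0 · sin θ1. Then the open quantum walk is diffusive: the sequence σ(t)/√t converges, as t → ∞, to |s0|·√(c1² + 4·c0²·s1² + 4·c0·s0·s1·(c1² − 2·c0²·s1²)) / |c0 − s0·s1|, where c0 = cos θ0, s0 = sin θ0, c1 = cos θ1, s1 = sin θ1. -/
open Matrix Complex Filter

/-- Local operation `P(θ0,θ1)`. -/
noncomputable def Pmat (θ0 θ1 : ℝ) : Matrix (Fin 2) (Fin 2) ℂ :=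
  !![0, (Real.cos θ0 : ℂ);
     ((Real.sin θ0 * Real.sin θ1 : ℝ) : ℂ), (-((Real.sin θ0 * Real.cos θ1 : ℝ) : ℂ))]

/-- Local operation `Q(θ0,θ1)`. -/
noncomputable def Qmat (θ0 θ1 : ℝ) : Matrix (Fin 2) (Fin 2) ℂ :=
  !![((Real.sin θ0 * Real.cos θ1 : ℝ) : ℂ), ((Real.sin θ0 * Real.sin θ1 : ℝ) : ℂ);
     (Real.cos θ0 : ℂ), 0]

/-- The open quantum walk on ℤ with initial state `diagonal (p, 1-p)` at the origin. -/
noncomputable def owalk (θ0 θ1 p : ℝ) : ℕ → ℤ → Matrix (Fin 2) (Fin 2) ℂ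
  | 0, x => if x = 0 then Matrix.diagonal ![(p : ℂ), ((1 - p : ℝ) : ℂ)] else 0
  | t + 1, x =>
      Pmat θ0 θ1 * owalk θ0 θ1 p t (x + 1) * (Pmat θ0 θ1)ᴴ
        + Qmat θ0 θ1 * owalk θ0 θ1 p t (x - 1) * (Qmat θ0 θ1)ᴴ

/-- Finding probability at position `x` at time `t`. -/
noncomputable def findprob (θ0 θ1 p : ℝ) (t : ℕ) (x : ℤ) : ℝ :=
  ((owalk θ0 θ1 p t x).trace).re

/-- First moment (finite sum: the walk vanishes outside `[-t, t]`). -/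
noncomputable def moment1 (θ0 θ1 p : ℝ) (t : ℕ) : ℝ :=
  ∑ x ∈ Finset.Icc (-(t : ℤ)) (t : ℤ), (x : ℝ) * findprob θ0 θ1 p t x

/-- Second moment. -/
noncomputable def moment2 (θ0 θ1 p : ℝ) (t : ℕ) : ℝ :=
  ∑ x ∈ Finset.Icc (-(t : ℤ)) (t : ℤ), (x : ℝ) ^ 2 * findprob θ0 θ1 p t x

/-- Standard deviation. -/
noncomputable def stdDev (θ0 θ1 p : ℝ) (t : ℕ) : ℝ :=
  Real.sqrt (moment2 θ0 θ1 p t - (moment1 θ0 θ1 p t) ^ 2)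

/-- Weighted sum of `g` over the window `[-t, t]`. -/
noncomputable def windowSum (t : ℕ) (f g : ℤ → ℝ) : ℝ :=
  ∑ x ∈ Finset.Icc (-(t : ℤ)) (t : ℤ), f x * g x

theorem windowSum_succ_shift (t : ℕ) (f g k : ℤ → ℝ)
    (hg : ∀ x, x ∉ Finset.Icc (-(t : ℤ)) (t : ℤ) → g x = 0)
    (hk : ∀ x, x ∉ Finset.Icc (-(t : ℤ)) (t : ℤ) → k x = 0) :
    windowSum (t + 1) f (fun x => g (x + 1) + k (x - 1)) =
      windowSum t (fun x => f (x - 1)) g + windowSum t (fun x => f (x + 1)) k := by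
  unfold windowSum
  simp only [mul_add, Finset.sum_add_distrib]
  congr 1
  · symm
    refine Finset.sum_bij_ne_zero (fun x _ _ => x - 1) ?_ ?_ ?_ ?_
    · intro x hx _
      simp only [Finset.mem_Icc] at hx ⊢
      push_cast
      omega
    · intro x _ _ y _ _ hxy
      simpa using hxy
    · intro y _ hy0
      refine ⟨y + 1, ?_, by simpa using hy0, by ring⟩
      by_contra hy
      exact hy0 (by rw [hg _ hy, mul_zero])
    · intro x _ _
      simp
  · symm
    refine Finset.sum_bij_ne_zero (fun x _ _ => x + 1) ?_ ?_ ?_ ?_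
    · intro x hx _
      simp only [Finset.mem_Icc] at hx ⊢
      push_cast
      omega
    · intro x _ _ y _ _ hxy
      simpa using hxy
    · intro y _ hy0
      refine ⟨y - 1, ?_, by simpa using hy0, by ring⟩
      by_contra hy
      exact hy0 (by rw [hk _ hy, mul_zero])
    · intro x _ _
      simp

theorem owalk_eq_zero (θ0 θ1 p : ℝ) (t : ℕ) :
    ∀ x, x ∉ Finset.Icc (-(t : ℤ)) (t : ℤ) → owalk θ0 θ1 p t x = 0 := by
  induction t with
  | zero =>
    intro x hx
    have hx0 : x ≠ 0 := by
      rintro rfl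
      simp at hx
    simp [owalk, hx0]
  | succ t ih =>
    intro x hx
    simp only [Finset.mem_Icc] at hx ih
    push_cast at hx
    rw [owalk, ih (x + 1) (by omega), ih (x - 1) (by omega)]
    simp

/-- The component of a matrix along `σ_z`: the real part of `tr (σ_z ρ)`. -/
noncomputable def blochZ (ρ : Matrix (Fin 2) (Fin 2) ℂ) : ℝ := (ρ 0 0 - ρ 1 1).re

/-- The component of a matrix along `σ_x`: the real part of `tr (σ_x ρ)`. -/
noncomputable def blochX (ρ : Matrix (Fin 2) (Fin 2) ℂ) : ℝ := (ρ 0 1 + ρ 1 0).re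

section Bloch

variable (θ0 θ1 : ℝ) (ρ : Matrix (Fin 2) (Fin 2) ℂ)

theorem trace_re_Pmat :
    (Pmat θ0 θ1 * ρ * (Pmat θ0 θ1)ᴴ).trace.re =
      (Real.sin θ0 * Real.sin θ1) ^ 2 * ((ρ.trace.re + blochZ ρ) / 2)
        - Real.sin θ0 * Real.sin θ1 * (Real.sin θ0 * Real.cos θ1) * blochX ρ
        + (Real.cos θ0 ^ 2 + (Real.sin θ0 * Real.cos θ1) ^ 2) *
          ((ρ.trace.re - blochZ ρ) / 2) := by
  simp only [Pmat, blochZ, blochX, Matrix.trace_fin_two, Matrix.mul_apply, Fin.sum_univ_two,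
    Matrix.conjTranspose_apply]
  simp [-Complex.ofReal_cos, -Complex.ofReal_sin]
  ring

theorem blochZ_Pmat :
    blochZ (Pmat θ0 θ1 * ρ * (Pmat θ0 θ1)ᴴ) =
      -(Real.sin θ0 * Real.sin θ1) ^ 2 * ((ρ.trace.re + blochZ ρ) / 2)
        + Real.sin θ0 * Real.sin θ1 * (Real.sin θ0 * Real.cos θ1) * blochX ρ
        + (Real.cos θ0 ^ 2 - (Real.sin θ0 * Real.cos θ1) ^ 2) *
          ((ρ.trace.re - blochZ ρ) / 2) := by
  simp only [Pmat, blochZ, blochX, Matrix.trace_fin_two, Matrix.mul_apply, Fin.sum_univ_two,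
    Matrix.conjTranspose_apply]
  simp [-Complex.ofReal_cos, -Complex.ofReal_sin]
  ring

theorem blochX_Pmat :
    blochX (Pmat θ0 θ1 * ρ * (Pmat θ0 θ1)ᴴ) =
      Real.cos θ0 * (Real.sin θ0 * Real.sin θ1) * blochX ρ
        - 2 * Real.cos θ0 * (Real.sin θ0 * Real.cos θ1) * ((ρ.trace.re - blochZ ρ) / 2) := by
  simp only [Pmat, blochZ, blochX, Matrix.trace_fin_two, Matrix.mul_apply, Fin.sum_univ_two,
    Matrix.conjTranspose_apply]
  simp [-Complex.ofReal_cos, -Complex.ofReal_sin]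
  ring

theorem trace_re_Qmat :
    (Qmat θ0 θ1 * ρ * (Qmat θ0 θ1)ᴴ).trace.re =
      (Real.cos θ0 ^ 2 + (Real.sin θ0 * Real.cos θ1) ^ 2) * ((ρ.trace.re + blochZ ρ) / 2)
        + Real.sin θ0 * Real.sin θ1 * (Real.sin θ0 * Real.cos θ1) * blochX ρ
        + (Real.sin θ0 * Real.sin θ1) ^ 2 * ((ρ.trace.re - blochZ ρ) / 2) := by
  simp only [Qmat, blochZ, blochX, Matrix.trace_fin_two, Matrix.mul_apply, Fin.sum_univ_two,
    Matrix.conjTranspose_apply]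
  simp [-Complex.ofReal_cos, -Complex.ofReal_sin]
  ring

theorem blochZ_Qmat :
    blochZ (Qmat θ0 θ1 * ρ * (Qmat θ0 θ1)ᴴ) =
      ((Real.sin θ0 * Real.cos θ1) ^ 2 - Real.cos θ0 ^ 2) * ((ρ.trace.re + blochZ ρ) / 2)
        + Real.sin θ0 * Real.sin θ1 * (Real.sin θ0 * Real.cos θ1) * blochX ρ
        + (Real.sin θ0 * Real.sin θ1) ^ 2 * ((ρ.trace.re - blochZ ρ) / 2) := by
  simp only [Qmat, blochZ, blochX, Matrix.trace_fin_two, Matrix.mul_apply, Fin.sum_univ_two,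
    Matrix.conjTranspose_apply]
  simp [-Complex.ofReal_cos, -Complex.ofReal_sin]
  ring

theorem blochX_Qmat :
    blochX (Qmat θ0 θ1 * ρ * (Qmat θ0 θ1)ᴴ) =
      Real.cos θ0 * (Real.sin θ0 * Real.sin θ1) * blochX ρ
        + 2 * Real.cos θ0 * (Real.sin θ0 * Real.cos θ1) * ((ρ.trace.re + blochZ ρ) / 2) := by
  simp only [Qmat, blochZ, blochX, Matrix.trace_fin_two, Matrix.mul_apply, Fin.sum_univ_two,
    Matrix.conjTranspose_apply]
  simp [-Complex.ofReal_cos, -Complex.ofReal_sin]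
  ring

end Bloch

/-- A functional of the state that is additive and vanishes at `0`, summed over the walk after
one step. -/
theorem windowSum_owalk_succ (θ0 θ1 p : ℝ) (F : Matrix (Fin 2) (Fin 2) ℂ → ℝ)
    (hadd : ∀ A B, F (A + B) = F A + F B) (hzero : F 0 = 0) (f : ℤ → ℝ) (t : ℕ) :
    windowSum (t + 1) f (fun x => F (owalk θ0 θ1 p (t + 1) x)) =
      windowSum t (fun x => f (x - 1))
          (fun x => F (Pmat θ0 θ1 * owalk θ0 θ1 p t x * (Pmat θ0 θ1)ᴴ))
        + windowSum t (fun x => f (x + 1))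
          (fun x => F (Qmat θ0 θ1 * owalk θ0 θ1 p t x * (Qmat θ0 θ1)ᴴ)) := by
  rw [← windowSum_succ_shift t f _ _
    (fun x hx => by rw [owalk_eq_zero θ0 θ1 p t x hx]; simpa using hzero)
    (fun x hx => by rw [owalk_eq_zero θ0 θ1 p t x hx]; simpa using hzero)]
  simp only [owalk, hadd]

/-- Moment of order `n` of the trace of the walk. -/
noncomputable def traceMoment (θ0 θ1 p : ℝ) (n t : ℕ) : ℝ :=
  windowSum t (fun x => (x : ℝ) ^ n) (fun x => (owalk θ0 θ1 p t x).trace.re)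

/-- Moment of order `n` of the `σ_z` component of the walk. -/
noncomputable def zMoment (θ0 θ1 p : ℝ) (n t : ℕ) : ℝ :=
  windowSum t (fun x => (x : ℝ) ^ n) (fun x => blochZ (owalk θ0 θ1 p t x))

/-- Moment of order `n` of the `σ_x` component of the walk. -/
noncomputable def xMoment (θ0 θ1 p : ℝ) (n t : ℕ) : ℝ :=
  windowSum t (fun x => (x : ℝ) ^ n) (fun x => blochX (owalk θ0 θ1 p t x))

theorem sq_add_sq_add_sq_eq_one (θ0 θ1 : ℝ) :
    Real.cos θ0 ^ 2 + (Real.sin θ0 * Real.sin θ1) ^ 2 + (Real.sin θ0 * Real.cos θ1) ^ 2 = 1 := by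
  linear_combination Real.sin_sq_add_cos_sq θ0 + Real.sin θ0 ^ 2 * Real.sin_sq_add_cos_sq θ1

theorem blochZ_add (A B : Matrix (Fin 2) (Fin 2) ℂ) : blochZ (A + B) = blochZ A + blochZ B := by
  simp [blochZ]; ring

theorem blochX_add (A B : Matrix (Fin 2) (Fin 2) ℂ) : blochX (A + B) = blochX A + blochX B := by
  simp [blochX]; ring

section Recurrences

variable (θ0 θ1 p : ℝ) (t : ℕ)

theorem traceMoment_zero_succ : traceMoment θ0 θ1 p 0 (t + 1) = traceMoment θ0 θ1 p 0 t := by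
  unfold traceMoment
  rw [windowSum_owalk_succ θ0 θ1 p (fun ρ => ρ.trace.re) (by simp) (by simp)]
  simp only [trace_re_Pmat, trace_re_Qmat, windowSum, ← Finset.sum_add_distrib]
  refine Finset.sum_congr rfl fun x _ => ?_
  linear_combination (owalk θ0 θ1 p t x).trace.re * sq_add_sq_add_sq_eq_one θ0 θ1

theorem zMoment_zero_succ :
    zMoment θ0 θ1 p 0 (t + 1) =
      ((Real.sin θ0 * Real.cos θ1) ^ 2 - (Real.sin θ0 * Real.sin θ1) ^ 2 - Real.cos θ0 ^ 2) *
          zMoment θ0 θ1 p 0 t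
        + 2 * (Real.sin θ0 * Real.sin θ1) * (Real.sin θ0 * Real.cos θ1) *
          xMoment θ0 θ1 p 0 t := by
  unfold zMoment xMoment
  rw [windowSum_owalk_succ θ0 θ1 p blochZ blochZ_add (by simp [blochZ])]
  simp only [blochZ_Pmat, blochZ_Qmat, windowSum, ← Finset.sum_add_distrib, Finset.mul_sum]
  refine Finset.sum_congr rfl fun x _ => ?_
  ring

theorem xMoment_zero_succ :
    xMoment θ0 θ1 p 0 (t + 1) =
      2 * Real.cos θ0 * (Real.sin θ0 * Real.cos θ1) * zMoment θ0 θ1 p 0 t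
        + 2 * Real.cos θ0 * (Real.sin θ0 * Real.sin θ1) * xMoment θ0 θ1 p 0 t := by
  unfold zMoment xMoment
  rw [windowSum_owalk_succ θ0 θ1 p blochX blochX_add (by simp [blochX])]
  simp only [blochX_Pmat, blochX_Qmat, windowSum, ← Finset.sum_add_distrib, Finset.mul_sum]
  refine Finset.sum_congr rfl fun x _ => ?_
  ring

theorem traceMoment_one_succ :
    traceMoment θ0 θ1 p 1 (t + 1) =
      traceMoment θ0 θ1 p 1 t
        + ((1 - 2 * (Real.sin θ0 * Real.sin θ1) ^ 2) * zMoment θ0 θ1 p 0 t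
        + 2 * (Real.sin θ0 * Real.sin θ1) * (Real.sin θ0 * Real.cos θ1) *
          xMoment θ0 θ1 p 0 t) := by
  unfold traceMoment zMoment xMoment
  rw [windowSum_owalk_succ θ0 θ1 p (fun ρ => ρ.trace.re) (by simp) (by simp)]
  simp only [trace_re_Pmat, trace_re_Qmat, windowSum, ← Finset.sum_add_distrib, Finset.mul_sum]
  refine Finset.sum_congr rfl fun x _ => ?_
  push_cast
  linear_combination (x * (owalk θ0 θ1 p t x).trace.re + blochZ (owalk θ0 θ1 p t x)) *
    sq_add_sq_add_sq_eq_one θ0 θ1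

theorem zMoment_one_succ :
    zMoment θ0 θ1 p 1 (t + 1) =
      ((Real.sin θ0 * Real.cos θ1) ^ 2 - (Real.sin θ0 * Real.sin θ1) ^ 2 - Real.cos θ0 ^ 2) *
          zMoment θ0 θ1 p 1 t
        + 2 * (Real.sin θ0 * Real.sin θ1) * (Real.sin θ0 * Real.cos θ1) *
          xMoment θ0 θ1 p 1 t
        + (1 - 2 * Real.cos θ0 ^ 2) * traceMoment θ0 θ1 p 0 t := by
  unfold traceMoment zMoment xMoment
  rw [windowSum_owalk_succ θ0 θ1 p blochZ blochZ_add (by simp [blochZ])]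
  simp only [blochZ_Pmat, blochZ_Qmat, windowSum, ← Finset.sum_add_distrib, Finset.mul_sum]
  refine Finset.sum_congr rfl fun x _ => ?_
  push_cast
  linear_combination (owalk θ0 θ1 p t x).trace.re * sq_add_sq_add_sq_eq_one θ0 θ1

theorem xMoment_one_succ :
    xMoment θ0 θ1 p 1 (t + 1) =
      2 * Real.cos θ0 * (Real.sin θ0 * Real.cos θ1) * zMoment θ0 θ1 p 1 t
        + 2 * Real.cos θ0 * (Real.sin θ0 * Real.sin θ1) * xMoment θ0 θ1 p 1 t
        + 2 * Real.cos θ0 * (Real.sin θ0 * Real.cos θ1) * traceMoment θ0 θ1 p 0 t := by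
  unfold traceMoment zMoment xMoment
  rw [windowSum_owalk_succ θ0 θ1 p blochX blochX_add (by simp [blochX])]
  simp only [blochX_Pmat, blochX_Qmat, windowSum, ← Finset.sum_add_distrib, Finset.mul_sum]
  refine Finset.sum_congr rfl fun x _ => ?_
  push_cast
  ring

theorem traceMoment_two_succ :
    traceMoment θ0 θ1 p 2 (t + 1) =
      traceMoment θ0 θ1 p 2 t
        + 2 * ((1 - 2 * (Real.sin θ0 * Real.sin θ1) ^ 2) * zMoment θ0 θ1 p 1 t
          + 2 * (Real.sin θ0 * Real.sin θ1) * (Real.sin θ0 * Real.cos θ1) *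
            xMoment θ0 θ1 p 1 t)
        + traceMoment θ0 θ1 p 0 t := by
  unfold traceMoment zMoment xMoment
  rw [windowSum_owalk_succ θ0 θ1 p (fun ρ => ρ.trace.re) (by simp) (by simp)]
  simp only [trace_re_Pmat, trace_re_Qmat, windowSum, ← Finset.sum_add_distrib, Finset.mul_sum]
  refine Finset.sum_congr rfl fun x _ => ?_
  push_cast
  linear_combination ((x ^ 2 + 1) * (owalk θ0 θ1 p t x).trace.re
    + 2 * x * blochZ (owalk θ0 θ1 p t x)) * sq_add_sq_add_sq_eq_one θ0 θ1

theorem traceMoment_zero_eq_one : traceMoment θ0 θ1 p 0 t = 1 := by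
  induction t with
  | zero => simp [traceMoment, windowSum, owalk, Matrix.trace_fin_two]
  | succ t ih => rw [traceMoment_zero_succ, ih]

end Recurrences

/-- The cumulative drift driven by a planar contraction without the eigenvalue `1` is bounded. -/
theorem exists_abs_le_of_recurrence (c u w : ℝ) (hsum : c ^ 2 + u ^ 2 + w ^ 2 = 1) (hcu : c ≠ u)
    (z x S : ℕ → ℝ)
    (hz : ∀ t, z (t + 1) = (w ^ 2 - u ^ 2 - c ^ 2) * z t + 2 * u * w * x t)
    (hx : ∀ t, x (t + 1) = 2 * c * w * z t + 2 * c * u * x t)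
    (hS : ∀ t, S (t + 1) = S t + ((1 - 2 * u ^ 2) * z t + 2 * u * w * x t)) :
    ∃ C, ∀ t, |S t| ≤ C := by
  have hd : c - u ≠ 0 := sub_ne_zero.mpr hcu
  set a := ((1 - 2 * u ^ 2) * (1 - 2 * c * u) + 4 * u * c * w ^ 2) / (2 * (c - u) ^ 2) with ha
  set b := ((1 - 2 * u ^ 2) * (2 * u * w) + 2 * u * w * (1 - (w ^ 2 - u ^ 2 - c ^ 2))) /
    (2 * (c - u) ^ 2) with hb
  have hab1 : a - (a * (w ^ 2 - u ^ 2 - c ^ 2) + b * (2 * c * w)) = 1 - 2 * u ^ 2 := by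
    have hw : w ^ 2 = 1 - c ^ 2 - u ^ 2 := by linarith
    rw [ha, hb]
    field_simp
    ring_nf
    simp only [hw]
    ring
  have hab2 : b - (a * (2 * u * w) + b * (2 * c * u)) = 2 * u * w := by
    have hw : w ^ 2 = 1 - c ^ 2 - u ^ 2 := by linarith
    rw [ha, hb]
    field_simp
    ring_nf
    simp only [show w ^ 3 = w ^ 2 * w by ring, hw]
    ring
  have hconst : ∀ t, S t = S 0 + a * z 0 + b * x 0 - (a * z t + b * x t) := by
    intro t
    induction t with
    | zero => ring
    | succ t ih =>
      rw [hS, hz, hx]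
      linear_combination ih - z t * hab1 - x t * hab2
  have hcontr : ∀ t, z t ^ 2 + x t ^ 2 ≤ z 0 ^ 2 + x 0 ^ 2 := by
    intro t
    induction t with
    | zero => exact le_rfl
    | succ t ih =>
      refine le_trans ?_ ih
      have key : z t ^ 2 + x t ^ 2 - (z (t + 1) ^ 2 + x (t + 1) ^ 2) =
          (2 * u * w * z t - (1 - 2 * u ^ 2) * x t) ^ 2 := by
        rw [hz, hx]
        have hc : c ^ 2 = 1 - u ^ 2 - w ^ 2 := by linarith
        ring_nf
        simp only [show c ^ 4 = (c ^ 2) ^ 2 by ring, hc]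
        ring
      nlinarith [sq_nonneg (2 * u * w * z t - (1 - 2 * u ^ 2) * x t)]
  refine ⟨|S 0 + a * z 0 + b * x 0| + (|a| * √(z 0 ^ 2 + x 0 ^ 2) + |b| * √(z 0 ^ 2 + x 0 ^ 2)),
    fun t => ?_⟩
  have hzt : |z t| ≤ √(z 0 ^ 2 + x 0 ^ 2) :=
    Real.abs_le_sqrt (by nlinarith [hcontr t, sq_nonneg (x t)])
  have hxt : |x t| ≤ √(z 0 ^ 2 + x 0 ^ 2) :=
    Real.abs_le_sqrt (by nlinarith [hcontr t, sq_nonneg (z t)])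
  rw [hconst t]
  refine (abs_sub _ _).trans ?_
  gcongr
  refine (abs_add_le _ _).trans ?_
  rw [abs_mul, abs_mul]
  gcongr

/-- The second moment differs from linear growth by a bounded error. -/
theorem exists_abs_traceMoment_two_sub_le (θ0 θ1 p : ℝ)
    (h : Real.cos θ0 ≠ Real.sin θ0 * Real.sin θ1) :
    ∃ C, ∀ t : ℕ, |traceMoment θ0 θ1 p 2 t - t * (Real.sin θ0 ^ 2 *
        (Real.cos θ1 ^ 2 + 4 * Real.cos θ0 ^ 2 * Real.sin θ1 ^ 2
          + 4 * Real.cos θ0 * Real.sin θ0 * Real.sin θ1 *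
            (Real.cos θ1 ^ 2 - 2 * Real.cos θ0 ^ 2 * Real.sin θ1 ^ 2)) /
        (Real.cos θ0 - Real.sin θ0 * Real.sin θ1) ^ 2)| ≤ C := by
  have hsum := sq_add_sq_add_sq_eq_one θ0 θ1
  have hz := zMoment_one_succ θ0 θ1 p
  have hx := xMoment_one_succ θ0 θ1 p
  have hm := traceMoment_two_succ θ0 θ1 p
  simp only [traceMoment_zero_eq_one] at hz hx hm
  set V := Real.sin θ0 ^ 2 *
        (Real.cos θ1 ^ 2 + 4 * Real.cos θ0 ^ 2 * Real.sin θ1 ^ 2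
          + 4 * Real.cos θ0 * Real.sin θ0 * Real.sin θ1 *
            (Real.cos θ1 ^ 2 - 2 * Real.cos θ0 ^ 2 * Real.sin θ1 ^ 2)) /
        (Real.cos θ0 - Real.sin θ0 * Real.sin θ1) ^ 2 with hV
  have hV' : V = ((Real.sin θ0 * Real.cos θ1) ^ 2
      + 4 * Real.cos θ0 ^ 2 * (Real.sin θ0 * Real.sin θ1) ^ 2
      + 4 * Real.cos θ0 * (Real.sin θ0 * Real.sin θ1) * ((Real.sin θ0 * Real.cos θ1) ^ 2
        - 2 * Real.cos θ0 ^ 2 * (Real.sin θ0 * Real.sin θ1) ^ 2)) /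
      (Real.cos θ0 - Real.sin θ0 * Real.sin θ1) ^ 2 := by
    rw [hV]
    ring
  clear_value V
  clear hV
  generalize Real.cos θ0 = c at *
  generalize Real.sin θ0 * Real.sin θ1 = u at *
  generalize Real.sin θ0 * Real.cos θ1 = w at *
  have hd : c - u ≠ 0 := sub_ne_zero.mpr h
  have hw : w ^ 2 = 1 - c ^ 2 - u ^ 2 := by linarith
  obtain ⟨z', hz'⟩ : ∃ z', z' = ((1 - 2 * c * u) * (1 - 2 * c ^ 2) + 2 * u * w * (2 * c * w)) /
    (2 * (c - u) ^ 2) := ⟨_, rfl⟩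
  obtain ⟨x', hx'⟩ : ∃ x', x' = (2 * c * w * (1 - 2 * c ^ 2)
    + (1 - (w ^ 2 - u ^ 2 - c ^ 2)) * (2 * c * w)) / (2 * (c - u) ^ 2) := ⟨_, rfl⟩
  have hfixz : z' = (w ^ 2 - u ^ 2 - c ^ 2) * z' + 2 * u * w * x' + (1 - 2 * c ^ 2) := by
    rw [hz', hx']
    field_simp
    ring_nf
    simp only [hw]
    ring
  have hfixx : x' = 2 * c * w * z' + 2 * c * u * x' + 2 * c * w := by
    rw [hz', hx']
    field_simp
    ring_nf
    simp only [show w ^ 3 = w ^ 2 * w by ring, hw]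
    ring
  have hVfix : V = 1 + 2 * ((1 - 2 * u ^ 2) * z' + 2 * u * w * x') := by
    rw [hV', hz', hx']
    field_simp
    ring_nf
    simp only [show w ^ 4 = (w ^ 2) ^ 2 by ring, hw]
    ring
  obtain ⟨C, hC⟩ := exists_abs_le_of_recurrence c u w hsum h
    (fun t => zMoment θ0 θ1 p 1 t - z') (fun t => xMoment θ0 θ1 p 1 t - x')
    (fun t => (traceMoment θ0 θ1 p 2 t - t * V) / 2)
    (fun t => by
      simp only [hz]
      linear_combination -hfixz)
    (fun t => by
      simp only [hx]
      linear_combination -hfixx)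
    (fun t => by
      simp only [hm]
      push_cast
      linear_combination -hVfix / 2)
  refine ⟨2 * C, fun t => ?_⟩
  have := hC t
  rw [abs_div, abs_two] at this
  linarith

theorem tendsto_div_natCast_of_abs_sub_le (m : ℕ → ℝ) (V C : ℝ)
    (hm : ∀ t : ℕ, |m t - t * V| ≤ C) :
    Filter.Tendsto (fun t : ℕ => m t / t) Filter.atTop (nhds V) := by
  have h0 : Filter.Tendsto (fun t : ℕ => (m t - t * V) / t) Filter.atTop (nhds 0) := by
    refine squeeze_zero_norm (fun t => ?_) (tendsto_const_div_atTop_nhds_zero_nat C)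
    rw [Real.norm_eq_abs, abs_div, Nat.abs_cast]
    gcongr
    exact hm t
  have h1 := h0.add_const V
  rw [zero_add] at h1
  refine h1.congr' ?_
  filter_upwards [Filter.eventually_gt_atTop 0] with t ht
  have : (t : ℝ) ≠ 0 := by positivity
  field_simp
  ring

theorem owalk_diffusive (θ0 θ1 p : ℝ) (hp0 : 0 ≤ p) (hp1 : p ≤ 1)
    (h : Real.cos θ0 ≠ Real.sin θ0 * Real.sin θ1) :
    Filter.Tendsto (fun t : ℕ => stdDev θ0 θ1 p t / Real.sqrt t) Filter.atTop
      (nhds (|Real.sin θ0| *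
        Real.sqrt (Real.cos θ1 ^ 2 + 4 * Real.cos θ0 ^ 2 * Real.sin θ1 ^ 2
          + 4 * Real.cos θ0 * Real.sin θ0 * Real.sin θ1 *
            (Real.cos θ1 ^ 2 - 2 * Real.cos θ0 ^ 2 * Real.sin θ1 ^ 2)) /
        |Real.cos θ0 - Real.sin θ0 * Real.sin θ1|)) := by
  obtain ⟨C₁, hC₁⟩ := exists_abs_le_of_recurrence _ _ _ (sq_add_sq_add_sq_eq_one θ0 θ1) h
    (zMoment θ0 θ1 p 0) (xMoment θ0 θ1 p 0) (traceMoment θ0 θ1 p 1)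
    (zMoment_zero_succ θ0 θ1 p) (xMoment_zero_succ θ0 θ1 p) (traceMoment_one_succ θ0 θ1 p)
  obtain ⟨C₂, hC₂⟩ := exists_abs_traceMoment_two_sub_le θ0 θ1 p h
  have h1 : ∀ t, moment1 θ0 θ1 p t = traceMoment θ0 θ1 p 1 t := fun t => by
    simp only [moment1, traceMoment, windowSum, findprob, pow_one]
  have h2 : ∀ t, moment2 θ0 θ1 p t = traceMoment θ0 θ1 p 2 t := fun _ => rfl
  have hvar := tendsto_div_natCast_of_abs_sub_le
    (fun t => moment2 θ0 θ1 p t - moment1 θ0 θ1 p t ^ 2) _ (C₂ + C₁ ^ 2) (fun t => by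
      rw [h1, h2, sub_right_comm]
      refine (abs_sub _ _).trans (add_le_add (hC₂ t) ?_)
      rw [abs_pow]
      exact pow_le_pow_left₀ (abs_nonneg _) (hC₁ t) 2)
  have hsqrt := hvar.sqrt
  rw [Real.sqrt_div' _ (sq_nonneg _), Real.sqrt_mul (sq_nonneg _), Real.sqrt_sq_eq_abs,
    Real.sqrt_sq_eq_abs] at hsqrt
  refine hsqrt.congr fun t => ?_
  rw [stdDev, Real.sqrt_div' _ (Nat.cast_nonneg t)]
end

section
/- Suppose sin θ0 · cos θ1 = 0 and cos θ0 ≠ sin θ0 · sin θ1. Then for every t ∈ ℕ the variance satisfies: E₂(t) − E₁(t)² = 4·c0²·s0²·t if t is even, and E₂(t) − E₁(t)² = 4·c0²·s0²·t + 4·p·(1 − p)·(2·c0² − 1)² if t is odd, where c0 = cos θ0 and s0 = sin θ0. -/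
open Matrix Complex Filter

/-- The walk is supported in `[-t, t]` at time `t`. -/
theorem owalk_eq_zero_of_notMem (θ0 θ1 p : ℝ) (t : ℕ) (x : ℤ)
    (hx : x ∉ Finset.Icc (-(t : ℤ)) (t : ℤ)) : owalk θ0 θ1 p t x = 0 := by
  induction t generalizing x with
  | zero =>
    have h0 : x ≠ 0 := by
      rintro rfl
      simp at hx
    simp [owalk, h0]
  | succ t ih =>
    rw [Finset.mem_Icc] at hx
    push_cast at hx
    have h1 : owalk θ0 θ1 p t (x + 1) = 0 := ih _ (by rw [Finset.mem_Icc]; omega)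
    have h2 : owalk θ0 θ1 p t (x - 1) = 0 := ih _ (by rw [Finset.mem_Icc]; omega)
    simp [owalk, h1, h2]

/-- The sum of `f x` against the real part of the `i`-th diagonal entry of the walk. -/
noncomputable def diagSum (θ0 θ1 p : ℝ) (t : ℕ) (i : Fin 2) (f : ℤ → ℝ) : ℝ :=
  ∑ x ∈ Finset.Icc (-(t : ℤ)) (t : ℤ), f x * (owalk θ0 θ1 p t x i i).re

theorem sum_findprob_eq_diagSum (θ0 θ1 p : ℝ) (t : ℕ) (f : ℤ → ℝ) :
    ∑ x ∈ Finset.Icc (-(t : ℤ)) (t : ℤ), f x * findprob θ0 θ1 p t x =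
      diagSum θ0 θ1 p t 0 f + diagSum θ0 θ1 p t 1 f := by
  simp [diagSum, findprob, Matrix.trace_fin_two, mul_add, Finset.sum_add_distrib]

theorem diagSum_add (θ0 θ1 p : ℝ) (t : ℕ) (i : Fin 2) (f g : ℤ → ℝ) :
    diagSum θ0 θ1 p t i (fun x => f x + g x) =
      diagSum θ0 θ1 p t i f + diagSum θ0 θ1 p t i g := by
  simp [diagSum, add_mul, Finset.sum_add_distrib]

theorem diagSum_const_mul (θ0 θ1 p : ℝ) (t : ℕ) (i : Fin 2) (r : ℝ) (f : ℤ → ℝ) :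
    diagSum θ0 θ1 p t i (fun x => r * f x) = r * diagSum θ0 θ1 p t i f := by
  simp [diagSum, mul_assoc, Finset.mul_sum]

/-- Shifting the summation variable of a function supported in `[-t, t]` by at most one step. -/
theorem sum_Icc_succ_shift (t : ℕ) (e : ℤ) (he : |e| ≤ 1) (f g : ℤ → ℝ)
    (hg : ∀ x ∉ Finset.Icc (-(t : ℤ)) (t : ℤ), g x = 0) :
    ∑ x ∈ Finset.Icc (-((t + 1 : ℕ) : ℤ)) ((t + 1 : ℕ) : ℤ), f x * g (x + e) =
      ∑ x ∈ Finset.Icc (-(t : ℤ)) (t : ℤ), f (x - e) * g x := by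
  rw [abs_le] at he
  symm
  refine Finset.sum_of_injOn (fun x => x - e) (fun x _ y _ h => by simpa using h) ?_ ?_ ?_
  · intro x hx
    simp only [Finset.coe_Icc, Set.mem_Icc] at hx ⊢
    push_cast
    omega
  · intro x _ hx
    rw [hg, mul_zero]
    exact fun h => hx ⟨x + e, by simpa using h, by simp⟩
  · simp

theorem sq_sin_mul_sin_eq_sq_sin (θ0 θ1 : ℝ) (hs : Real.sin θ0 * Real.cos θ1 = 0) :
    (Real.sin θ0 * Real.sin θ1) ^ 2 = Real.sin θ0 ^ 2 := by
  linear_combination Real.sin θ0 ^ 2 * Real.sin_sq_add_cos_sq θ1 -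
    Real.sin θ0 * Real.cos θ1 * hs

theorem owalk_succ_zero_zero_re (θ0 θ1 p : ℝ) (hs : Real.sin θ0 * Real.cos θ1 = 0)
    (t : ℕ) (x : ℤ) :
    (owalk θ0 θ1 p (t + 1) x 0 0).re =
      Real.cos θ0 ^ 2 * (owalk θ0 θ1 p t (x + 1) 1 1).re +
        Real.sin θ0 ^ 2 * (owalk θ0 θ1 p t (x + -1) 1 1).re := by
  rw [← sq_sin_mul_sin_eq_sq_sin θ0 θ1 hs, ← sub_eq_add_neg]
  simp only [owalk, Pmat, Qmat, hs, Matrix.add_apply, Matrix.mul_apply, Fin.sum_univ_two,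
    Matrix.conjTranspose_apply, Complex.add_re]
  simp [-Complex.ofReal_cos, -Complex.ofReal_sin, -Complex.ofReal_mul]
  ring

theorem owalk_succ_one_one_re (θ0 θ1 p : ℝ) (hs : Real.sin θ0 * Real.cos θ1 = 0)
    (t : ℕ) (x : ℤ) :
    (owalk θ0 θ1 p (t + 1) x 1 1).re =
      Real.sin θ0 ^ 2 * (owalk θ0 θ1 p t (x + 1) 0 0).re +
        Real.cos θ0 ^ 2 * (owalk θ0 θ1 p t (x + -1) 0 0).re := by
  rw [← sq_sin_mul_sin_eq_sq_sin θ0 θ1 hs, ← sub_eq_add_neg]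
  simp only [owalk, Pmat, Qmat, hs, Matrix.add_apply, Matrix.mul_apply, Fin.sum_univ_two,
    Matrix.conjTranspose_apply, Complex.add_re]
  simp [-Complex.ofReal_cos, -Complex.ofReal_sin, -Complex.ofReal_mul]
  ring

theorem diagSum_succ_zero (θ0 θ1 p : ℝ) (hs : Real.sin θ0 * Real.cos θ1 = 0)
    (t : ℕ) (f : ℤ → ℝ) :
    diagSum θ0 θ1 p (t + 1) 0 f = diagSum θ0 θ1 p t 1
      (fun x => Real.cos θ0 ^ 2 * f (x - 1) + Real.sin θ0 ^ 2 * f (x + 1)) := by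
  have hsupp : ∀ x ∉ Finset.Icc (-(t : ℤ)) (t : ℤ), (owalk θ0 θ1 p t x 1 1).re = 0 :=
    fun x hx => by simp [owalk_eq_zero_of_notMem θ0 θ1 p t x hx]
  have h1 := sum_Icc_succ_shift t 1 (by simp) f _ hsupp
  have h2 := sum_Icc_succ_shift t (-1) (by simp) f _ hsupp
  simp only [sub_neg_eq_add] at h2
  rw [diagSum_add, diagSum_const_mul, diagSum_const_mul, diagSum, diagSum, diagSum, ← h1, ← h2,
    Finset.mul_sum, Finset.mul_sum, ← Finset.sum_add_distrib]
  refine Finset.sum_congr rfl fun x _ => ?_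
  rw [owalk_succ_zero_zero_re θ0 θ1 p hs]
  ring

theorem diagSum_succ_one (θ0 θ1 p : ℝ) (hs : Real.sin θ0 * Real.cos θ1 = 0)
    (t : ℕ) (f : ℤ → ℝ) :
    diagSum θ0 θ1 p (t + 1) 1 f = diagSum θ0 θ1 p t 0
      (fun x => Real.sin θ0 ^ 2 * f (x - 1) + Real.cos θ0 ^ 2 * f (x + 1)) := by
  have hsupp : ∀ x ∉ Finset.Icc (-(t : ℤ)) (t : ℤ), (owalk θ0 θ1 p t x 0 0).re = 0 :=
    fun x hx => by simp [owalk_eq_zero_of_notMem θ0 θ1 p t x hx]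
  have h1 := sum_Icc_succ_shift t 1 (by simp) f _ hsupp
  have h2 := sum_Icc_succ_shift t (-1) (by simp) f _ hsupp
  simp only [sub_neg_eq_add] at h2
  rw [diagSum_add, diagSum_const_mul, diagSum_const_mul, diagSum, diagSum, diagSum, ← h1, ← h2,
    Finset.mul_sum, Finset.mul_sum, ← Finset.sum_add_distrib]
  refine Finset.sum_congr rfl fun x _ => ?_
  rw [owalk_succ_one_one_re θ0 θ1 p hs]
  ring

/-- One step of the walk acting on the moments of order at most two. -/
theorem diagSum_moments_succ (θ0 θ1 p : ℝ) (hs : Real.sin θ0 * Real.cos θ1 = 0)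
    (t : ℕ) :
    diagSum θ0 θ1 p (t + 1) 0 (fun _ => 1) = diagSum θ0 θ1 p t 1 (fun _ => 1) ∧
    diagSum θ0 θ1 p (t + 1) 1 (fun _ => 1) = diagSum θ0 θ1 p t 0 (fun _ => 1) ∧
    diagSum θ0 θ1 p (t + 1) 0 (fun x => (x : ℝ)) = diagSum θ0 θ1 p t 1 (fun x => (x : ℝ)) -
      (2 * Real.cos θ0 ^ 2 - 1) * diagSum θ0 θ1 p t 1 (fun _ => 1) ∧
    diagSum θ0 θ1 p (t + 1) 1 (fun x => (x : ℝ)) = diagSum θ0 θ1 p t 0 (fun x => (x : ℝ)) +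
      (2 * Real.cos θ0 ^ 2 - 1) * diagSum θ0 θ1 p t 0 (fun _ => 1) ∧
    diagSum θ0 θ1 p (t + 1) 0 (fun x => (x : ℝ) ^ 2) =
      diagSum θ0 θ1 p t 1 (fun x => (x : ℝ) ^ 2) -
      2 * (2 * Real.cos θ0 ^ 2 - 1) * diagSum θ0 θ1 p t 1 (fun x => (x : ℝ)) +
      diagSum θ0 θ1 p t 1 (fun _ => 1) ∧
    diagSum θ0 θ1 p (t + 1) 1 (fun x => (x : ℝ) ^ 2) =
      diagSum θ0 θ1 p t 0 (fun x => (x : ℝ) ^ 2) +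
      2 * (2 * Real.cos θ0 ^ 2 - 1) * diagSum θ0 θ1 p t 0 (fun x => (x : ℝ)) +
      diagSum θ0 θ1 p t 0 (fun _ => 1) := by
  simp only [diagSum_succ_zero θ0 θ1 p hs, diagSum_succ_one θ0 θ1 p hs, Real.sin_sq,
    Int.cast_add, Int.cast_sub, Int.cast_one]
  refine ⟨?_, ?_, ?_, ?_, ?_, ?_⟩ <;>
  · simp only [diagSum, Finset.mul_sum, ← Finset.sum_add_distrib, ← Finset.sum_sub_distrib]
    exact Finset.sum_congr rfl fun x _ => by ring

/-- The moments of the two diagonal entries at even times. -/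
theorem diagSum_moments_two_mul (θ0 θ1 p : ℝ) (hs : Real.sin θ0 * Real.cos θ1 = 0)
    (n : ℕ) :
    diagSum θ0 θ1 p (2 * n) 0 (fun _ => 1) = p ∧
    diagSum θ0 θ1 p (2 * n) 1 (fun _ => 1) = 1 - p ∧
    diagSum θ0 θ1 p (2 * n) 0 (fun x => (x : ℝ)) = 0 ∧
    diagSum θ0 θ1 p (2 * n) 1 (fun x => (x : ℝ)) = 0 ∧
    diagSum θ0 θ1 p (2 * n) 0 (fun x => (x : ℝ) ^ 2) +
      diagSum θ0 θ1 p (2 * n) 1 (fun x => (x : ℝ) ^ 2) =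
      4 * Real.cos θ0 ^ 2 * Real.sin θ0 ^ 2 * ((2 * n : ℕ) : ℝ) := by
  induction n with
  | zero => simp [diagSum, owalk]
  | succ n ih =>
    obtain ⟨a0, b0, a1, b1, e2⟩ := ih
    obtain ⟨a0', b0', a1', b1', a2', b2'⟩ := diagSum_moments_succ θ0 θ1 p hs (2 * n)
    obtain ⟨a0'', b0'', a1'', b1'', a2'', b2''⟩ := diagSum_moments_succ θ0 θ1 p hs (2 * n + 1)
    rw [show 2 * (n + 1) = 2 * n + 1 + 1 by ring, a0'', b0'', a1'', b1'', a2'', b2'', a0', b0',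
      a1', b1', a2', b2', a0, b0, a1, b1]
    refine ⟨rfl, rfl, by ring, by ring, ?_⟩
    rw [Real.sin_sq] at e2 ⊢
    push_cast at e2 ⊢
    linear_combination e2

theorem owalk_variance_parity (θ0 θ1 p : ℝ) (hp0 : 0 ≤ p) (hp1 : p ≤ 1)
    (hs : Real.sin θ0 * Real.cos θ1 = 0)
    (hne : Real.cos θ0 ≠ Real.sin θ0 * Real.sin θ1) :
    ∀ t : ℕ,
      (Even t → moment2 θ0 θ1 p t - (moment1 θ0 θ1 p t) ^ 2 =
        4 * Real.cos θ0 ^ 2 * Real.sin θ0 ^ 2 * t) ∧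
      (Odd t → moment2 θ0 θ1 p t - (moment1 θ0 θ1 p t) ^ 2 =
        4 * Real.cos θ0 ^ 2 * Real.sin θ0 ^ 2 * t
          + 4 * p * (1 - p) * (2 * Real.cos θ0 ^ 2 - 1) ^ 2) := by
  intro t
  rw [moment1, moment2, sum_findprob_eq_diagSum θ0 θ1 p t (fun x => (x : ℝ)),
    sum_findprob_eq_diagSum θ0 θ1 p t (fun x => (x : ℝ) ^ 2)]
  constructor
  · intro ht
    obtain ⟨n, rfl⟩ := ht.two_dvd
    obtain ⟨-, -, a1, b1, e2⟩ := diagSum_moments_two_mul θ0 θ1 p hs n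
    rw [a1, b1, e2]
    ring
  · rintro ⟨n, rfl⟩
    obtain ⟨a0, b0, a1, b1, e2⟩ := diagSum_moments_two_mul θ0 θ1 p hs n
    obtain ⟨-, -, a1', b1', a2', b2'⟩ := diagSum_moments_succ θ0 θ1 p hs (2 * n)
    rw [a1', b1', a2', b2', a0, b0, a1, b1]
    rw [Real.sin_sq] at e2 ⊢
    push_cast at e2 ⊢
    linear_combination e2
end
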